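/- Let (a,b,c) and (a',b',c') be triples of positive integers with a ≤ a', b ≤ b', c ≤ c'. Then for every type-1 configuration C of [a,b,c] there exist a type-1 configuration C' of [a',b',c'] and a bijection φ from the cuboids of C to the cuboids of C' such that two cuboids of C touch if and only if their images under φ touch; in particular, the contact graphs of C and C' are isomorphic. -/

import Mathlib

/-- A cuboid with integer root and integer dimensions. -/
structure Cuboid where
  root : ℤ × ℤ × ℤ
  dims : ℤ × ℤ × ℤ
deriving DecidableEq

namespace Cuboid

/-- The dimensions are positive. -/
def valid (C : Cuboid) : Prop :=
  0 < C.dims.1 ∧ 0 < C.dims.2.1 ∧ 0 < C.dims.2.2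

/-- The closed cuboid `[x,x+a] × [y,y+b] × [z,z+c] ⊆ ℝ³`. -/
def toSet (C : Cuboid) : Set (ℝ × ℝ × ℝ) :=
  {p | (C.root.1 : ℝ) ≤ p.1 ∧ p.1 ≤ C.root.1 + C.dims.1 ∧
       (C.root.2.1 : ℝ) ≤ p.2.1 ∧ p.2.1 ≤ C.root.2.1 + C.dims.2.1 ∧
       (C.root.2.2 : ℝ) ≤ p.2.2 ∧ p.2.2 ≤ C.root.2.2 + C.dims.2.2}

/-- The open cuboid `(x,x+a) × (y,y+b) × (z,z+c) ⊆ ℝ³` (the interior). -/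
def inte (C : Cuboid) : Set (ℝ × ℝ × ℝ) :=
  {p | (C.root.1 : ℝ) < p.1 ∧ p.1 < C.root.1 + C.dims.1 ∧
       (C.root.2.1 : ℝ) < p.2.1 ∧ p.2.1 < C.root.2.1 + C.dims.2.1 ∧
       (C.root.2.2 : ℝ) < p.2.2 ∧ p.2.2 < C.root.2.2 + C.dims.2.2}

/-- The set `(ℤ×ℤ×ℝ) ∪ (ℤ×ℝ×ℤ) ∪ (ℝ×ℤ×ℤ)` of grid lines. -/
def grid : Set (ℝ × ℝ × ℝ) :=
  {p | ((∃ m : ℤ, p.1 = m) ∧ (∃ n : ℤ, p.2.1 = n)) ∨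
       ((∃ m : ℤ, p.1 = m) ∧ (∃ n : ℤ, p.2.2 = n)) ∨
       ((∃ m : ℤ, p.2.1 = m) ∧ (∃ n : ℤ, p.2.2 = n))}

/-- Two cuboids collide when their interiors intersect. -/
def Collide (C D : Cuboid) : Prop := (C.inte ∩ D.inte).Nonempty

/-- Two cuboids touch when their interiors are disjoint but their intersection
contains a point outside the grid lines (i.e. it is a non-degenerate rectangle). -/
def Touch (C D : Cuboid) : Prop :=
  ¬ Collide C D ∧ ∃ p ∈ C.toSet ∩ D.toSet, p ∉ grid

end Cuboid

/-- A configuration: a finite family of valid pairwise non-colliding cuboids. -/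
def IsConfig (F : Finset Cuboid) : Prop :=
  (∀ C ∈ F, C.valid) ∧ ∀ C ∈ F, ∀ D ∈ F, C ≠ D → ¬ Cuboid.Collide C D

/-- A type-1 configuration of `[a,b,c]`: every cuboid has dimensions exactly `(a,b,c)`. -/
def Type1 (a b c : ℕ) (F : Finset Cuboid) : Prop :=
  ∀ C ∈ F, C.dims = ((a : ℤ), (b : ℤ), (c : ℤ))

/-- A type-2 configuration of `[a,b,c]`: every cuboid has dimensions `(a,b,c)` or `(b,a,c)`. -/
def Type2 (a b c : ℕ) (F : Finset Cuboid) : Prop :=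
  ∀ C ∈ F, C.dims = ((a : ℤ), (b : ℤ), (c : ℤ)) ∨ C.dims = ((b : ℤ), (a : ℤ), (c : ℤ))

/-- A type-3 configuration of `[a,b,c]`: every cuboid's dimensions are a permutation of `(a,b,c)`. -/
def Type3 (a b c : ℕ) (F : Finset Cuboid) : Prop :=
  ∀ C ∈ F, C.dims = ((a : ℤ), (b : ℤ), (c : ℤ)) ∨ C.dims = ((a : ℤ), (c : ℤ), (b : ℤ)) ∨
    C.dims = ((b : ℤ), (a : ℤ), (c : ℤ)) ∨ C.dims = ((b : ℤ), (c : ℤ), (a : ℤ)) ∨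
    C.dims = ((c : ℤ), (a : ℤ), (b : ℤ)) ∨ C.dims = ((c : ℤ), (b : ℤ), (a : ℤ))

/-- A proper `k`-coloring of a configuration: touching cuboids get distinct colors. -/
def ProperColoring (k : ℕ) (F : Finset Cuboid) : Prop :=
  ∃ κ : Cuboid → Fin k, ∀ C ∈ F, ∀ D ∈ F, Cuboid.Touch C D → κ C ≠ κ D

/-- A strictly increasing integer map that turns translation by `a` into translation by `a'`. -/
theorem exists_strictMono_map_add {a a' : ℤ} (ha : 0 < a) (haa : a ≤ a') :
    ∃ f : ℤ → ℤ, StrictMono f ∧ ∀ x, f (x + a) = f x + a' := by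
  refine ⟨fun x => a' * (x / a) + x % a, fun x y hxy => ?_, fun x => ?_⟩
  · have hx := Int.mul_ediv_add_emod x a
    have hy := Int.mul_ediv_add_emod y a
    have hx' := Int.emod_lt_of_pos x ha
    have hy' := Int.emod_nonneg y ha.ne'
    rcases (Int.ediv_le_ediv ha hxy.le).eq_or_lt with h | h
    · rw [h] at hx
      simp only [h]
      linarith
    · dsimp only
      nlinarith [mul_le_mul_of_nonneg_left (Int.add_one_le_iff.mpr h) (ha.le.trans haa)]
  · simp only [Int.add_ediv_of_dvd_right (dvd_refl a), Int.ediv_self ha.ne', Int.add_emod_right]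
    ring

section Interval

variable (x y a : ℤ)

theorem exists_mem_Ioo_inter_iff :
    (∃ p : ℝ, ((x : ℝ) < p ∧ p < x + a) ∧ ((y : ℝ) < p ∧ p < y + a)) ↔
      0 < a ∧ y < x + a ∧ x < y + a := by
  constructor
  · rintro ⟨p, ⟨h1, h2⟩, h3, h4⟩
    refine ⟨?_, ?_, ?_⟩ <;> (rify; linarith)
  · rintro ⟨h0, h1, h2⟩
    refine ⟨(max x y : ℤ) + 1 / 2, ?_⟩
    rcases le_total x y with h | h <;> simp only [max_eq_left, max_eq_right, h] <;>
      (rify [← Int.add_one_le_iff] at *; refine ⟨⟨?_, ?_⟩, ?_, ?_⟩ <;> linarith)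

theorem exists_nonint_mem_Icc_inter_iff :
    (∃ p : ℝ, ((x : ℝ) ≤ p ∧ p ≤ x + a) ∧ ((y : ℝ) ≤ p ∧ p ≤ y + a) ∧ ¬ ∃ m : ℤ, p = m) ↔
      0 < a ∧ y < x + a ∧ x < y + a := by
  constructor
  · rintro ⟨p, ⟨h1, h2⟩, ⟨h3, h4⟩, hp⟩
    have h1' := h1.lt_of_ne fun h => hp ⟨x, h.symm⟩
    have h3' := h3.lt_of_ne fun h => hp ⟨y, h.symm⟩
    refine ⟨?_, ?_, ?_⟩ <;> (rify; linarith)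
  · rintro ⟨h0, h1, h2⟩
    refine ⟨(max x y : ℤ) + 1 / 2, ?_⟩
    rw [← and_assoc]
    constructor
    · rcases le_total x y with h | h <;> simp only [max_eq_left, max_eq_right, h] <;>
        (rify [← Int.add_one_le_iff] at *; refine ⟨⟨?_, ?_⟩, ?_, ?_⟩ <;> linarith)
    · rintro ⟨m, hm⟩
      have h : 2 * max x y + 1 = 2 * m := by
        rify
        push_cast at hm
        linarith
      omega

theorem exists_mem_Icc_inter_iff :
    (∃ p : ℝ, ((x : ℝ) ≤ p ∧ p ≤ x + a) ∧ ((y : ℝ) ≤ p ∧ p ≤ y + a)) ↔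
      0 ≤ a ∧ y ≤ x + a ∧ x ≤ y + a := by
  constructor
  · rintro ⟨p, ⟨h1, h2⟩, h3, h4⟩
    refine ⟨?_, ?_, ?_⟩ <;> (rify; linarith)
  · rintro ⟨h0, h1, h2⟩
    refine ⟨(max x y : ℤ), ?_⟩
    rcases le_total x y with h | h <;> simp only [max_eq_left, max_eq_right, h] <;>
      (rify at *; refine ⟨⟨?_, ?_⟩, ?_, ?_⟩ <;> linarith)

end Interval

namespace Cuboid

variable {x y z u v w a b c : ℤ}

theorem collide_iff (ha : 0 < a) (hb : 0 < b) (hc : 0 < c) :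
    Collide ⟨(x, y, z), (a, b, c)⟩ ⟨(u, v, w), (a, b, c)⟩ ↔
      (u < x + a ∧ x < u + a) ∧ (v < y + b ∧ y < v + b) ∧ (w < z + c ∧ z < w + c) := by
  have hx := exists_mem_Ioo_inter_iff x u a
  have hy := exists_mem_Ioo_inter_iff y v b
  have hz := exists_mem_Ioo_inter_iff z w c
  simp only [ha, hb, hc, true_and] at hx hy hz
  rw [← hx, ← hy, ← hz]
  constructor
  · rintro ⟨⟨p, q, r⟩, ⟨h1, h2, h3, h4, h5, h6⟩, h7, h8, h9, h10, h11, h12⟩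
    exact ⟨⟨p, ⟨h1, h2⟩, h7, h8⟩, ⟨q, ⟨h3, h4⟩, h9, h10⟩, ⟨r, ⟨h5, h6⟩, h11, h12⟩⟩
  · rintro ⟨⟨p, ⟨h1, h2⟩, h7, h8⟩, ⟨q, ⟨h3, h4⟩, h9, h10⟩, ⟨r, ⟨h5, h6⟩, h11, h12⟩⟩
    exact ⟨(p, q, r), ⟨h1, h2, h3, h4, h5, h6⟩, h7, h8, h9, h10, h11, h12⟩

theorem notMem_grid_iff {p q r : ℝ} :
    (p, q, r) ∉ grid ↔
      ((∃ m : ℤ, p = m) → ¬ ∃ m : ℤ, q = m) ∧ ((∃ m : ℤ, p = m) → ¬ ∃ m : ℤ, r = m) ∧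
        ((∃ m : ℤ, q = m) → ¬ ∃ m : ℤ, r = m) := by
  simp only [grid, Set.mem_ofPred_eq, not_or, not_and]

theorem exists_mem_inter_notMem_grid_iff (ha : 0 < a) (hb : 0 < b) (hc : 0 < c) :
    (∃ p ∈ toSet ⟨(x, y, z), (a, b, c)⟩ ∩ toSet ⟨(u, v, w), (a, b, c)⟩, p ∉ grid) ↔
      ((u ≤ x + a ∧ x ≤ u + a) ∧ (v < y + b ∧ y < v + b) ∧ (w < z + c ∧ z < w + c)) ∨
      ((u < x + a ∧ x < u + a) ∧ (v ≤ y + b ∧ y ≤ v + b) ∧ (w < z + c ∧ z < w + c)) ∨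
      ((u < x + a ∧ x < u + a) ∧ (v < y + b ∧ y < v + b) ∧ (w ≤ z + c ∧ z ≤ w + c)) := by
  have hx := exists_nonint_mem_Icc_inter_iff x u a
  have hy := exists_nonint_mem_Icc_inter_iff y v b
  have hz := exists_nonint_mem_Icc_inter_iff z w c
  have hx' := exists_mem_Icc_inter_iff x u a
  have hy' := exists_mem_Icc_inter_iff y v b
  have hz' := exists_mem_Icc_inter_iff z w c
  simp only [ha, hb, hc, ha.le, hb.le, hc.le, true_and] at hx hy hz hx' hy' hz'
  rw [← hx, ← hy, ← hz, ← hx', ← hy', ← hz']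
  constructor
  · rintro ⟨⟨p, q, r⟩, ⟨⟨h1, h2, h3, h4, h5, h6⟩, h7, h8, h9, h10, h11, h12⟩, hg⟩
    obtain ⟨hpq, hpr, hqr⟩ := notMem_grid_iff.mp hg
    by_cases hp : ∃ m : ℤ, p = m
    · exact .inl ⟨⟨p, ⟨h1, h2⟩, h7, h8⟩, ⟨q, ⟨h3, h4⟩, ⟨h9, h10⟩, hpq hp⟩,
        ⟨r, ⟨h5, h6⟩, ⟨h11, h12⟩, hpr hp⟩⟩
    by_cases hq : ∃ m : ℤ, q = m
    · exact .inr (.inl ⟨⟨p, ⟨h1, h2⟩, ⟨h7, h8⟩, hp⟩, ⟨q, ⟨h3, h4⟩, h9, h10⟩,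
        ⟨r, ⟨h5, h6⟩, ⟨h11, h12⟩, hqr hq⟩⟩)
    · exact .inr (.inr ⟨⟨p, ⟨h1, h2⟩, ⟨h7, h8⟩, hp⟩, ⟨q, ⟨h3, h4⟩, ⟨h9, h10⟩, hq⟩,
        ⟨r, ⟨h5, h6⟩, h11, h12⟩⟩)
  · rintro (⟨⟨p, ⟨h1, h2⟩, h7, h8⟩, ⟨q, ⟨h3, h4⟩, ⟨h9, h10⟩, hq⟩, ⟨r, ⟨h5, h6⟩, ⟨h11, h12⟩, hr⟩⟩ |
      ⟨⟨p, ⟨h1, h2⟩, ⟨h7, h8⟩, hp⟩, ⟨q, ⟨h3, h4⟩, h9, h10⟩, ⟨r, ⟨h5, h6⟩, ⟨h11, h12⟩, hr⟩⟩ |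
      ⟨⟨p, ⟨h1, h2⟩, ⟨h7, h8⟩, hp⟩, ⟨q, ⟨h3, h4⟩, ⟨h9, h10⟩, hq⟩, ⟨r, ⟨h5, h6⟩, h11, h12⟩⟩) <;>
    refine ⟨(p, q, r), ⟨⟨h1, h2, h3, h4, h5, h6⟩, h7, h8, h9, h10, h11, h12⟩,
      notMem_grid_iff.mpr ?_⟩
    · exact ⟨fun _ => hq, fun _ => hr, fun _ => hr⟩
    · exact ⟨fun h => absurd h hp, fun _ => hr, fun _ => hr⟩
    · exact ⟨fun _ => hq, fun h => absurd h hp, fun h => absurd h hq⟩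

/-- Move the root of a cuboid coordinatewise by `f`, `g`, `h` and reset its dimensions to `d`. -/
def rescale (f g h : ℤ → ℤ) (d : ℤ × ℤ × ℤ) (C : Cuboid) : Cuboid :=
  ⟨(f C.root.1, g C.root.2.1, h C.root.2.2), d⟩

section Rescale

variable {a' b' c' : ℤ} {f g h : ℤ → ℤ} {C D : Cuboid}

theorem collide_rescale_iff (ha : 0 < a) (hb : 0 < b) (hc : 0 < c)
    (ha' : 0 < a') (hb' : 0 < b') (hc' : 0 < c')
    (hf : StrictMono f) (hg : StrictMono g) (hh : StrictMono h)
    (hfa : ∀ x, f (x + a) = f x + a') (hgb : ∀ x, g (x + b) = g x + b')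
    (hhc : ∀ x, h (x + c) = h x + c') (hC : C.dims = (a, b, c)) (hD : D.dims = (a, b, c)) :
    Collide (rescale f g h (a', b', c') C) (rescale f g h (a', b', c') D) ↔ Collide C D := by
  obtain ⟨⟨x, y, z⟩, _⟩ := C
  obtain ⟨⟨u, v, w⟩, _⟩ := D
  subst hC hD
  simp only [rescale, collide_iff ha hb hc, collide_iff ha' hb' hc', ← hfa, ← hgb, ← hhc,
    hf.lt_iff_lt, hg.lt_iff_lt, hh.lt_iff_lt]

theorem touch_rescale_iff (ha : 0 < a) (hb : 0 < b) (hc : 0 < c)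
    (ha' : 0 < a') (hb' : 0 < b') (hc' : 0 < c')
    (hf : StrictMono f) (hg : StrictMono g) (hh : StrictMono h)
    (hfa : ∀ x, f (x + a) = f x + a') (hgb : ∀ x, g (x + b) = g x + b')
    (hhc : ∀ x, h (x + c) = h x + c') (hC : C.dims = (a, b, c)) (hD : D.dims = (a, b, c)) :
    Touch (rescale f g h (a', b', c') C) (rescale f g h (a', b', c') D) ↔ Touch C D := by
  unfold Touch
  rw [collide_rescale_iff ha hb hc ha' hb' hc' hf hg hh hfa hgb hhc hC hD]
  obtain ⟨⟨x, y, z⟩, _⟩ := C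
  obtain ⟨⟨u, v, w⟩, _⟩ := D
  subst hC hD
  simp only [rescale, exists_mem_inter_notMem_grid_iff ha hb hc,
    exists_mem_inter_notMem_grid_iff ha' hb' hc', ← hfa, ← hgb, ← hhc,
    hf.lt_iff_lt, hg.lt_iff_lt, hh.lt_iff_lt, hf.le_iff_le, hg.le_iff_le, hh.le_iff_le]

end Rescale

end Cuboid

/-- **Rescaling lemma.** Enlarging the dimensions preserves contact graphs of
type-1 configurations. -/
theorem rescaling_preserves_contact_graph
    (a b c a' b' c' : ℕ) (ha : 0 < a) (hb : 0 < b) (hc : 0 < c)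
    (haa : a ≤ a') (hbb : b ≤ b') (hcc : c ≤ c')
    (F : Finset Cuboid) (hF : IsConfig F) (h1 : Type1 a b c F) :
    ∃ F' : Finset Cuboid, IsConfig F' ∧ Type1 a' b' c' F' ∧
      ∃ φ : {C // C ∈ F} ≃ {C // C ∈ F'},
        ∀ u v : {C // C ∈ F},
          Cuboid.Touch u.1 v.1 ↔ Cuboid.Touch (φ u).1 (φ v).1 := by
  have ha₀ : (0 : ℤ) < a := by exact_mod_cast ha
  have hb₀ : (0 : ℤ) < b := by exact_mod_cast hb
  have hc₀ : (0 : ℤ) < c := by exact_mod_cast hc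
  have ha' : (0 : ℤ) < a' := by exact_mod_cast ha.trans_le haa
  have hb' : (0 : ℤ) < b' := by exact_mod_cast hb.trans_le hbb
  have hc' : (0 : ℤ) < c' := by exact_mod_cast hc.trans_le hcc
  obtain ⟨f, hf, hfa⟩ := exists_strictMono_map_add ha₀ (Int.ofNat_le.mpr haa)
  obtain ⟨g, hg, hgb⟩ := exists_strictMono_map_add hb₀ (Int.ofNat_le.mpr hbb)
  obtain ⟨h, hh, hhc⟩ := exists_strictMono_map_add hc₀ (Int.ofNat_le.mpr hcc)
  set ψ : Cuboid → Cuboid := Cuboid.rescale f g h (a', b', c') with hψ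
  have hinj : Set.InjOn ψ F := by
    rintro ⟨⟨x, y, z⟩, _⟩ hC ⟨⟨u, v, w⟩, _⟩ hD hCD
    have hdC := h1 _ hC
    have hdD := h1 _ hD
    simp only at hdC hdD
    simp only [hψ, Cuboid.rescale, Cuboid.mk.injEq, Prod.mk.injEq, hf.injective.eq_iff,
      hg.injective.eq_iff, hh.injective.eq_iff, and_true] at hCD
    simp [hdC, hdD, hCD]
  refine ⟨F.image ψ, ⟨?_, ?_⟩, ?_, (Equiv.Set.imageOfInjOn ψ F hinj).trans
    (Equiv.subtypeEquivRight fun C => by simp), ?_⟩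
  · simp only [Finset.forall_mem_image]
    exact fun C _ => ⟨ha', hb', hc'⟩
  · simp only [Finset.forall_mem_image]
    intro C hC D hD hne
    rw [Cuboid.collide_rescale_iff ha₀ hb₀ hc₀ ha' hb' hc' hf hg hh hfa hgb hhc (h1 C hC) (h1 D hD)]
    exact hF.2 C hC D hD fun hCD => hne (hCD ▸ rfl)
  · simp only [Type1, Finset.forall_mem_image]
    exact fun C _ => rfl
  · rintro ⟨C, hC⟩ ⟨D, hD⟩
    exact (Cuboid.touch_rescale_iff ha₀ hb₀ hc₀ ha' hb' hc' hf hg hh hfa hgb hhc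
      (h1 C hC) (h1 D hD)).symm
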